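/- Let k ≥ 4. Consider the action of the symmetric group Σ_k = Equiv.Perm (Fin k) on tuples x : Fin k → ℂ by permuting coordinates (σ • x = x ∘ σ⁻¹), which preserves both M(2,k) and Conf(ℂ,k). Equip the orbit spaces M(2,k)/Σ_k and Conf(ℂ,k)/Σ_k with the quotient topology, and let i(2,k) : M(2,k)/Σ_k → Conf(ℂ,k)/Σ_k be the continuous map induced by the inclusion M(2,k) ⊆ Conf(ℂ,k). Then i(2,k) does not admit a cross-section up to homotopy: there is no continuous map s : Conf(ℂ,k)/Σ_k → M(2,k)/Σ_k such that the composite i(2,k) ∘ s is homotopic to the identity map of Conf(ℂ,k)/Σ_k. -/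

import Mathlib

/-- The `t`-fold center of mass arrangement: tuples of `k` points in `ℂ` such that
any two distinct `t`-element subsets of indices have distinct sums. -/
def centerMassArrangement (t k : ℕ) : Set (Fin k → ℂ) :=
  {x | ∀ S T : Finset (Fin k), S.card = t → T.card = t → S ≠ T →
    (∑ i ∈ S, x i) ≠ ∑ i ∈ T, x i}

/-- The configuration space of `k` distinct ordered points of `ℂ`. -/
def configSpace (k : ℕ) : Set (Fin k → ℂ) :=
  {x | Function.Injective x}

/-- The orbit equivalence relation on a `Σ_k`-invariant subset `P ⊆ (Fin k → ℂ)`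
induced by the action of the symmetric group `Σ_k` permuting coordinates
(`σ • x = x ∘ σ⁻¹`): two tuples are equivalent when they differ by a permutation
of the coordinates. -/
def permSetoid {k : ℕ} (P : Set (Fin k → ℂ)) : Setoid P where
  r x y := ∃ σ : Equiv.Perm (Fin k), (x : Fin k → ℂ) = (y : Fin k → ℂ) ∘ σ
  iseqv := by
    constructor
    · intro x
      exact ⟨Equiv.refl _, rfl⟩
    · rintro x y ⟨σ, h⟩
      refine ⟨σ.symm, funext fun i => ?_⟩
      simp [h]
    · rintro x y z ⟨σ, h⟩ ⟨τ, h'⟩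
      refine ⟨σ.trans τ, funext fun i => ?_⟩
      simp [h, h']


theorem configSpace_isOpen (k : ℕ) : IsOpen (configSpace k) := by
  have : configSpace k = ⋂ (a : Fin k), ⋂ (b : Fin k), ⋂ (_ : a ≠ b), {x | x a ≠ x b} := by
    ext x
    simp only [configSpace, Set.mem_setOf_eq, Set.mem_iInter]
    constructor
    · intro h a b hab e
      exact hab (h e)
    · intro h a b e
      by_contra hab
      exact h a b hab e
  rw [this]
  refine isOpen_iInter_of_finite fun a => isOpen_iInter_of_finite fun b =>
    isOpen_iInter_of_finite fun _ => ?_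
  exact isOpen_ne_fun (continuous_apply a) (continuous_apply b)

/-- The action of the symmetric group on the configuration space. -/
instance confAction (k : ℕ) : MulAction (Equiv.Perm (Fin k)) (configSpace k) where
  smul σ x := ⟨(x : Fin k → ℂ) ∘ ⇑(σ⁻¹), fun _ _ h => (σ⁻¹).injective (x.2 h)⟩
  one_smul x := by
    apply Subtype.ext
    rfl
  mul_smul σ τ x := by
    apply Subtype.ext
    funext j
    change (x : Fin k → ℂ) ((σ * τ)⁻¹ j) = (x : Fin k → ℂ) (τ⁻¹ (σ⁻¹ j))
    rw [mul_inv_rev]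
    rfl

theorem confAction_coe {k : ℕ} (σ : Equiv.Perm (Fin k)) (x : configSpace k) :
    ((σ • x : configSpace k) : Fin k → ℂ) = (x : Fin k → ℂ) ∘ ⇑(σ⁻¹) := rfl

instance confContinuous (k : ℕ) : ContinuousConstSMul (Equiv.Perm (Fin k)) (configSpace k) where
  continuous_const_smul σ := by
    refine Continuous.subtype_mk ?_ _
    refine continuous_pi fun j => ?_
    exact (continuous_apply _).comp continuous_subtype_val

theorem conf_mk_eq {k : ℕ} {x y : configSpace k} :
    Quotient.mk (permSetoid (configSpace k)) x = Quotient.mk (permSetoid (configSpace k)) y ↔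
      x ∈ MulAction.orbit (Equiv.Perm (Fin k)) y := by
  rw [Quotient.eq]
  constructor
  · rintro ⟨σ, h⟩
    refine ⟨σ⁻¹, Subtype.ext ?_⟩
    simp only [confAction_coe, inv_inv]
    exact h.symm
  · rintro ⟨σ, rfl⟩
    exact ⟨σ⁻¹, rfl⟩

theorem conf_covering (k : ℕ) :
    IsCoveringMap (Quotient.mk (permSetoid (configSpace k))) := by
  have : LocallyCompactSpace (configSpace k) := (configSpace_isOpen k).locallyCompactSpace
  have : IsCancelSMul (Equiv.Perm (Fin k)) (configSpace k) := by
    rw [isCancelSMul_iff_eq_one_of_smul_eq]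
    intro σ x h
    have h1 : (x : Fin k → ℂ) ∘ ⇑(σ⁻¹) = x := congrArg Subtype.val h
    rw [← inv_eq_one]
    ext j
    have h2 := x.2 (congrFun h1 j)
    rw [h2]
    rfl
  have hq : Topology.IsQuotientMap (Quotient.mk (permSetoid (configSpace k))) :=
    isQuotientMap_quotient_mk'
  exact (hq.isQuotientCoveringMap_of_properlyDiscontinuousSMul
    (G := Equiv.Perm (Fin k)) conf_mk_eq).isCoveringMap

theorem exists_equivariant (k : ℕ)
    (hsub : centerMassArrangement 2 k ⊆ configSpace k)
    (i : C(Quotient (permSetoid (centerMassArrangement 2 k)),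
           Quotient (permSetoid (configSpace k))))
    (hi : ∀ x : centerMassArrangement 2 k,
      i (Quotient.mk (permSetoid (centerMassArrangement 2 k)) x) =
        Quotient.mk (permSetoid (configSpace k)) ⟨(x : Fin k → ℂ), hsub x.2⟩)
    (s : C(Quotient (permSetoid (configSpace k)),
              Quotient (permSetoid (centerMassArrangement 2 k))))
    (hs : (i.comp s).Homotopic (ContinuousMap.id _)) :
    ∃ f : C(configSpace k, configSpace k),
      (∀ x, (f x : Fin k → ℂ) ∈ centerMassArrangement 2 k) ∧
      ∀ (σ : Equiv.Perm (Fin k)) (x : configSpace k), f (σ • x) = σ • f x := by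
  obtain ⟨H⟩ := hs.symm
  have cov := conf_covering k
  let q : C(configSpace k, Quotient (permSetoid (configSpace k))) :=
    ⟨Quotient.mk (permSetoid (configSpace k)), continuous_quotient_mk'⟩
  have hqs : ∀ (σ : Equiv.Perm (Fin k)) x, q (σ • x) = q x := fun σ x =>
    conf_mk_eq.2 ⟨σ, rfl⟩
  let K : C(unitInterval × configSpace k, Quotient (permSetoid (configSpace k))) :=
    H.toContinuousMap.comp ((ContinuousMap.id unitInterval).prodMap q)
  have hK : ∀ t x, K (t, x) = H (t, q x) := fun _ _ => rfl
  have hK0 : ∀ a, K (0, a) = Quotient.mk (permSetoid (configSpace k)) (ContinuousMap.id _ a) := by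
    intro a
    rw [hK, H.apply_zero]
    rfl
  let L := cov.liftHomotopy K (ContinuousMap.id _) hK0
  have hL : ∀ t x, q (L (t, x)) = K (t, x) := fun t x =>
    congrFun (cov.liftHomotopy_lifts K (ContinuousMap.id _) hK0) (t, x)
  have hL0 : ∀ x, L (0, x) = x := fun x =>
    cov.liftHomotopy_zero K (ContinuousMap.id _) hK0 x
  refine ⟨L.comp ((ContinuousMap.const _ (1 : unitInterval)).prodMk (ContinuousMap.id (configSpace k))), ?_, ?_⟩
  · intro x
    change (L (1, x) : Fin k → ℂ) ∈ _
    have h1 := hL 1 x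
    rw [hK, H.apply_one] at h1
    obtain ⟨y, hy⟩ := Quotient.exists_rep (s (q x))
    have h2 : q (L (1, x)) = i (s (q x)) := h1
    rw [← hy, hi] at h2
    obtain ⟨σ, hσ⟩ := Quotient.exact h2
    rw [hσ]
    intro S T hS hT hST
    have := y.2 (S.map σ.toEmbedding) (T.map σ.toEmbedding) (by simpa using hS)
      (by simpa using hT) (by simpa using hST)
    simpa using this
  · intro σ x
    change L (1, σ • x) = σ • L (1, x)
    let L' : C(unitInterval × configSpace k, configSpace k) :=
      ⟨fun p => σ⁻¹ • L (p.1, σ • p.2), by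
        have h : Continuous fun p : unitInterval × configSpace k => (p.1, σ • p.2) :=
          continuous_fst.prodMk (continuous_snd.const_smul σ)
        exact (L.continuous.comp h).const_smul σ⁻¹⟩
    have hL' : L' = L := by
      refine (cov.eq_liftHomotopy_iff' hK0 L').2 ⟨?_, ?_⟩
      · funext ⟨t, a⟩
        change q (σ⁻¹ • L (t, σ • a)) = _
        rw [hqs, hL, hK, hqs, hK]
      · intro a
        change σ⁻¹ • L (0, σ • a) = a
        rw [hL0, inv_smul_smul]
    have h3 : σ⁻¹ • L (1, σ • x) = L (1, x) := DFunLike.congr_fun hL' (1, x)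
    rw [← h3, smul_inv_smul]

theorem const_of_exp_const {l : ℝ → ℂ} (hl : Continuous l) {c : ℂ}
    (h : ∀ x, Complex.exp (l x) = c) (x y : ℝ) : l x = l y := by
  refine Complex.isCoveringMap_exp.const_of_comp hl (fun a b => ?_) x y
  apply Subtype.ext
  change Complex.exp (l a) = Complex.exp (l b)
  rw [h, h]

theorem exp_eq_neg_one {z : ℂ} (h : Complex.exp z = -1) :
    ∃ n : ℤ, z = (2 * n + 1) * (Real.pi * Complex.I) := by
  rw [← Complex.exp_pi_mul_I, Complex.exp_eq_exp_iff_exists_int] at h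
  obtain ⟨n, hn⟩ := h
  exact ⟨n, by rw [hn]; ring⟩

theorem winding_contradiction (G : ℝ × ℝ → ℂ) (hG : Continuous G) (h0 : ∀ p, G p ≠ 0)
    (h1 : ∀ θ u, G (θ + 1, u) = G (θ, u))
    (h4 : ∀ θ, G (θ + 1 / 4, 0) = -G (θ, 0))
    (h2 : ∀ θ, G (θ + 1 / 2, 1) = -G (θ, 1)) : False := by
  obtain ⟨L, ⟨-, hL⟩, -⟩ := Complex.isCoveringMapOn_exp.existsUnique_continuousMap_lifts
    ⟨G, hG⟩ (a₀ := (0, 0)) (Complex.exp_log (h0 (0, 0))) (fun a => h0 a)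
  have hLe : ∀ p, Complex.exp (L p) = G p := fun p => congrFun hL p
  have e1 : L (0 + 1, 0) - L (0, 0) = L (0 + 1, 1) - L (0, 1) := by
    refine const_of_exp_const (l := fun u => L (0 + 1, u) - L (0, u)) (by fun_prop) (c := 1)
      (fun u => ?_) 0 1
    rw [Complex.exp_sub, hLe, hLe, h1, div_self (h0 _)]
  have q : ∀ θ, Complex.exp (L (θ + 1 / 4, 0) - L (θ, 0)) = -1 := fun θ => by
    rw [Complex.exp_sub, hLe, hLe, h4, neg_div, div_self (h0 _)]
  have r : ∀ θ, Complex.exp (L (θ + 1 / 2, 1) - L (θ, 1)) = -1 := fun θ => by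
    rw [Complex.exp_sub, hLe, hLe, h2, neg_div, div_self (h0 _)]
  have q' := const_of_exp_const (l := fun θ => L (θ + 1 / 4, 0) - L (θ, 0)) (by fun_prop) q
  have r' := const_of_exp_const (l := fun θ => L (θ + 1 / 2, 1) - L (θ, 1)) (by fun_prop) r
  obtain ⟨m, hm⟩ := exp_eq_neg_one (q 0)
  obtain ⟨n, hn⟩ := exp_eq_neg_one (r 0)
  have q1 := q' (1 / 4) 0
  have q2 := q' (1 / 2) 0
  have q3 := q' (3 / 4) 0
  have r1 := r' (1 / 2) 0
  norm_num at e1 q1 q2 q3 r1 hm hn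
  have key : 4 * ((2 * m + 1) * (Real.pi * Complex.I)) =
      2 * ((2 * n + 1) * (Real.pi * Complex.I) : ℂ) := by
    linear_combination -4 * hm + 2 * hn + e1 - q1 - q2 - q3 + r1
  have hpi : (Real.pi * Complex.I : ℂ) ≠ 0 := by simp [Real.pi_ne_zero]
  have key2 : (4 * (2 * m + 1) : ℂ) = 2 * (2 * n + 1) := by
    apply mul_right_cancel₀ hpi
    linear_combination key
  have key3 : 4 * (2 * m + 1) = 2 * (2 * n + 1) := by exact_mod_cast key2
  omega

/-- The point `exp (2 π i θ)` of the unit circle. -/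
noncomputable def cis (θ : ℝ) : ℂ := Complex.exp (2 * Real.pi * Complex.I * θ)

/-- The two-parameter family of configurations: four points which are rotated, and the other
points standing still far away. -/
noncomputable def pt (θ u : ℝ) : ℕ → ℂ
  | 0 => cis θ * ((1 + Complex.I) / 2 + (1 - Complex.I) / 2 * cis (u / 2))
  | 1 => cis θ * ((1 + Complex.I) / 2 - (1 - Complex.I) / 2 * cis (u / 2))
  | 2 => cis θ * (-1)
  | 3 => cis θ * (-Complex.I)
  | n + 4 => (n + 10 : ℕ)

theorem cis_norm (θ : ℝ) : ‖cis θ‖ = 1 := by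
  rw [cis, Complex.norm_exp]
  simp

theorem cis_add (a b : ℝ) : cis (a + b) = cis a * cis b := by
  rw [cis, cis, cis, ← Complex.exp_add]
  push_cast
  ring_nf

theorem cis_zero : cis 0 = 1 := by simp [cis]

theorem cis_one : cis 1 = 1 := by simp [cis]

theorem cis_half : cis (1 / 2) = -1 := by
  rw [cis, ← Complex.exp_pi_mul_I]
  push_cast
  ring_nf

theorem cis_quarter : cis (1 / 4) = Complex.I := by
  refine Eq.trans ?_ Complex.exp_pi_div_two_mul_I
  rw [cis]
  push_cast
  ring_nf

theorem cis_ne (θ : ℝ) : cis θ ≠ 0 := Complex.exp_ne_zero _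

theorem cis_continuous : Continuous cis := by
  unfold cis
  fun_prop

theorem pt_continuous (j : ℕ) : Continuous fun p : ℝ × ℝ => pt p.1 p.2 j := by
  have := cis_continuous
  match j with
  | 0 => simp only [pt]; fun_prop
  | 1 => simp only [pt]; fun_prop
  | 2 => simp only [pt]; fun_prop
  | 3 => simp only [pt]; fun_prop
  | n + 4 => simp only [pt]; fun_prop

theorem pt_zero_inj {w : ℂ} (hw : ‖w‖ = 1) :
    let A : ℂ := (1 + Complex.I) / 2
    let B : ℂ := (1 - Complex.I) / 2
    A + B * w ≠ A - B * w ∧ A + B * w ≠ -1 ∧ A - B * w ≠ -1 ∧ A + B * w ≠ -Complex.I ∧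
      A - B * w ≠ -Complex.I ∧ (-1 : ℂ) ≠ -Complex.I := by
  have hn : Complex.normSq w = 1 := by rw [Complex.normSq_eq_norm_sq, hw]; norm_num
  rw [Complex.normSq_apply] at hn
  obtain ⟨a, b⟩ := w
  simp only at hn
  refine ⟨?_, ?_, ?_, ?_, ?_, ?_⟩ <;> intro h <;> rw [Complex.ext_iff] at h <;>
    norm_num [Complex.div_re, Complex.div_im, Complex.normSq_apply] at h <;>
    obtain ⟨h1, h2⟩ := h <;> nlinarith

theorem pt_norm_lt (θ u : ℝ) (j : ℕ) (hj : j < 4) : ‖pt θ u j‖ < 10 := by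
  have hA : ‖(1 + Complex.I) / 2‖ ≤ 1 := by
    rw [norm_div]
    have := norm_add_le 1 Complex.I
    norm_num at this ⊢
    linarith
  have hB : ‖(1 - Complex.I) / 2 * cis (u / 2)‖ ≤ 1 := by
    rw [norm_mul, cis_norm, norm_div]
    have := norm_sub_le 1 Complex.I
    norm_num at this ⊢
    linarith
  interval_cases j
  · simp only [pt, norm_mul, cis_norm, one_mul]
    have := norm_add_le ((1 + Complex.I) / 2) ((1 - Complex.I) / 2 * cis (u / 2))
    linarith
  · simp only [pt, norm_mul, cis_norm, one_mul]
    have := norm_sub_le ((1 + Complex.I) / 2) ((1 - Complex.I) / 2 * cis (u / 2))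
    linarith
  · simp [pt, cis_norm]
  · simp [pt, cis_norm]

theorem pt_norm_ge (θ u : ℝ) (j : ℕ) (hj : 4 ≤ j) : 10 ≤ ‖pt θ u j‖ := by
  obtain ⟨n, rfl⟩ := Nat.exists_eq_add_of_le' hj
  simp only [pt, Complex.norm_natCast]
  push_cast
  linarith [Nat.cast_nonneg (α := ℝ) n]

theorem pt_inj_lt (θ u : ℝ) (a b : ℕ) (hab : a < b) : pt θ u a ≠ pt θ u b := by
  obtain ⟨g1, g2, g3, g4, g5, g6⟩ := pt_zero_inj (cis_norm (u / 2))
  have hc := cis_ne θ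
  by_cases hb : b < 4
  · have : a < 4 := by omega
    interval_cases b <;> interval_cases a <;> simp only [pt] <;> intro h <;>
      have h := mul_left_cancel₀ hc h <;> contradiction
  · by_cases ha : a < 4
    · intro h
      have h1 := pt_norm_lt θ u a ha
      have h2 := pt_norm_ge θ u b (by omega)
      rw [h] at h1
      linarith
    · obtain ⟨n, rfl⟩ := Nat.exists_eq_add_of_le' (not_lt.1 ha)
      obtain ⟨m, rfl⟩ := Nat.exists_eq_add_of_le' (not_lt.1 hb)
      simp only [pt]
      intro h
      have : n + 10 = m + 10 := by exact_mod_cast h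
      omega

/-- The two-parameter family as a map to the configuration space. -/
noncomputable def fam (k : ℕ) (p : ℝ × ℝ) : configSpace k :=
  ⟨fun j => pt p.1 p.2 j, by
    intro a b h
    by_contra hab
    rcases lt_or_gt_of_ne (fun e => hab (Fin.ext e)) with h' | h'
    · exact pt_inj_lt _ _ _ _ h' h
    · exact pt_inj_lt _ _ _ _ h' h.symm⟩

theorem fam_continuous (k : ℕ) : Continuous (fam k) := by
  refine Continuous.subtype_mk ?_ _
  exact continuous_pi fun j => pt_continuous (j : ℕ)

/-- **No cross-section up to homotopy.** Let `k ≥ 4`. The inclusion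
`M(2,k) ⊆ Conf(ℂ,k)` induces a continuous map
`i(2,k) : M(2,k)/Σ_k → Conf(ℂ,k)/Σ_k` between the orbit spaces (with quotient
topologies). There is no continuous map `s : Conf(ℂ,k)/Σ_k → M(2,k)/Σ_k` with
`i(2,k) ∘ s` homotopic to the identity. -/
theorem no_homotopy_section (k : ℕ) (hk : 4 ≤ k)
    (hsub : centerMassArrangement 2 k ⊆ configSpace k)
    (i : C(Quotient (permSetoid (centerMassArrangement 2 k)),
           Quotient (permSetoid (configSpace k))))
    (hi : ∀ x : centerMassArrangement 2 k,
      i (Quotient.mk (permSetoid (centerMassArrangement 2 k)) x) =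
        Quotient.mk (permSetoid (configSpace k)) ⟨(x : Fin k → ℂ), hsub x.2⟩) :
    ¬ ∃ s : C(Quotient (permSetoid (configSpace k)),
              Quotient (permSetoid (centerMassArrangement 2 k))),
        (i.comp s).Homotopic (ContinuousMap.id _) := by
  rintro ⟨s, hs⟩
  obtain ⟨f, hf, hfe⟩ := exists_equivariant k hsub i hi s hs
  obtain ⟨i0, hi0⟩ : ∃ j : Fin k, j.val = 0 := ⟨⟨0, by omega⟩, rfl⟩
  obtain ⟨i1, hi1⟩ : ∃ j : Fin k, j.val = 1 := ⟨⟨1, by omega⟩, rfl⟩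
  obtain ⟨i2, hi2⟩ : ∃ j : Fin k, j.val = 2 := ⟨⟨2, by omega⟩, rfl⟩
  obtain ⟨i3, hi3⟩ : ∃ j : Fin k, j.val = 3 := ⟨⟨3, by omega⟩, rfl⟩
  have n01 : i0 ≠ i1 := fun h => by rw [h] at hi0; omega
  have n02 : i0 ≠ i2 := fun h => by rw [h] at hi0; omega
  have n03 : i0 ≠ i3 := fun h => by rw [h] at hi0; omega
  have n12 : i1 ≠ i2 := fun h => by rw [h] at hi1; omega
  have n13 : i1 ≠ i3 := fun h => by rw [h] at hi1; omega
  have n23 : i2 ≠ i3 := fun h => by rw [h] at hi2; omega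
  have hcases : ∀ j : Fin k, j = i0 ∨ j = i1 ∨ j = i2 ∨ j = i3 ∨ ∃ n, j.val = n + 4 := by
    intro j
    by_cases h : 4 ≤ j.val
    · exact Or.inr (Or.inr (Or.inr (Or.inr (Nat.exists_eq_add_of_le' h))))
    · simp only [Fin.ext_iff]
      omega
  have hfam : ∀ p (j : Fin k), (fam k p : Fin k → ℂ) j = pt p.1 p.2 j := fun _ _ => rfl
  -- equivariance in composed form
  have hfe' : ∀ (σ : Equiv.Perm (Fin k)) (x y : configSpace k),
      (∀ j, (y : Fin k → ℂ) j = (x : Fin k → ℂ) (σ j)) →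
      ∀ j, (f y : Fin k → ℂ) j = (f x : Fin k → ℂ) (σ j) := by
    intro σ x y hxy j
    have hy : y = σ⁻¹ • x := by
      apply Subtype.ext
      funext j
      rw [confAction_coe, inv_inv]
      exact hxy j
    rw [hy, hfe, confAction_coe, inv_inv]
    rfl
  let G : ℝ × ℝ → ℂ := fun p => (f (fam k p) : Fin k → ℂ) i0 + (f (fam k p) : Fin k → ℂ) i2
    - ((f (fam k p) : Fin k → ℂ) i1 + (f (fam k p) : Fin k → ℂ) i3)
  have hc : ∀ j : Fin k, Continuous fun p => (f (fam k p) : Fin k → ℂ) j := fun j =>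
    (continuous_apply j).comp (continuous_subtype_val.comp (f.continuous.comp (fam_continuous k)))
  refine winding_contradiction G ?_ ?_ ?_ ?_ ?_
  · exact ((hc _).add (hc _)).sub ((hc _).add (hc _))
  · intro p
    have := hf (fam k p) {i0, i2} {i1, i3} (Finset.card_pair n02) (Finset.card_pair n13)
      (fun h => by
        have h0 : i0 ∈ ({i1, i3} : Finset (Fin k)) := h ▸ Finset.mem_insert_self _ _
        simp only [Finset.mem_insert, Finset.mem_singleton] at h0
        tauto)
    rw [Finset.sum_pair n02, Finset.sum_pair n13] at this
    exact sub_ne_zero.2 this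
  · intro θ u
    have : fam k (θ + 1, u) = fam k (θ, u) := by
      apply Subtype.ext
      funext j
      rw [hfam, hfam]
      rcases hcases j with rfl | rfl | rfl | rfl | ⟨n, hn⟩
      · simp only [hi0, pt, cis_add, cis_one, mul_one]
      · simp only [hi1, pt, cis_add, cis_one, mul_one]
      · simp only [hi2, pt, cis_add, cis_one, mul_one]
      · simp only [hi3, pt, cis_add, cis_one, mul_one]
      · simp only [hn, pt]
    simp only [G, this]
  · intro θ
    obtain ⟨σ, s0, s1, s2, s3, s4⟩ : ∃ σ : Equiv.Perm (Fin k), σ i0 = i1 ∧ σ i1 = i2 ∧ σ i2 = i3 ∧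
        σ i3 = i0 ∧ ∀ j, j ≠ i0 → j ≠ i1 → j ≠ i2 → j ≠ i3 → σ j = j := by
      refine ⟨Equiv.swap i0 i1 * Equiv.swap i1 i2 * Equiv.swap i2 i3, ?_, ?_, ?_, ?_, ?_⟩
      all_goals simp only [Equiv.Perm.mul_apply, Equiv.swap_apply_def]
      all_goals grind
    have key := hfe' σ (fam k (θ, 0)) (fam k (θ + 1 / 4, 0)) (by
      intro j
      rw [hfam, hfam]
      have hI := Complex.I_mul_I
      rcases hcases j with rfl | rfl | rfl | rfl | ⟨n, hn⟩
      · simp only [s0, hi0, hi1, pt, cis_add, cis_quarter, zero_div, cis_zero]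
        ring
      · simp only [s1, hi2, hi1, pt, cis_add, cis_quarter, zero_div, cis_zero]
        linear_combination (cis θ) * hI
      · simp only [s2, hi2, hi3, pt, cis_add, cis_quarter, zero_div, cis_zero]
        ring
      · simp only [s3, hi3, hi0, pt, cis_add, cis_quarter, zero_div, cis_zero]
        linear_combination -(cis θ) * hI
      · rw [s4 j (by rintro rfl; omega) (by rintro rfl; omega) (by rintro rfl; omega)
          (by rintro rfl; omega)]
        simp only [hn, pt])
    simp only [G, key, s0, s1, s2, s3]
    ring
  · intro θ
    obtain ⟨σ, s0, s1, s2, s3, s4⟩ : ∃ σ : Equiv.Perm (Fin k), σ i0 = i3 ∧ σ i1 = i2 ∧ σ i2 = i1 ∧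
        σ i3 = i0 ∧ ∀ j, j ≠ i0 → j ≠ i1 → j ≠ i2 → j ≠ i3 → σ j = j := by
      refine ⟨Equiv.swap i0 i3 * Equiv.swap i1 i2, ?_, ?_, ?_, ?_, ?_⟩
      all_goals simp only [Equiv.Perm.mul_apply, Equiv.swap_apply_def]
      all_goals grind
    have key := hfe' σ (fam k (θ, 1)) (fam k (θ + 1 / 2, 1)) (by
      intro j
      rw [hfam, hfam]
      rcases hcases j with rfl | rfl | rfl | rfl | ⟨n, hn⟩
      · simp only [s0, hi0, hi3, pt, cis_add, cis_half]
        ring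
      · simp only [s1, hi2, hi1, pt, cis_add, cis_half]
        ring
      · simp only [s2, hi2, hi1, pt, cis_add, cis_half]
        ring
      · simp only [s3, hi3, hi0, pt, cis_add, cis_half]
        ring
      · rw [s4 j (by rintro rfl; omega) (by rintro rfl; omega) (by rintro rfl; omega)
          (by rintro rfl; omega)]
        simp only [hn, pt])
    simp only [G, key, s0, s1, s2, s3]
    ring
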